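/- Let G be a parity game and j ∈ {0,1} a player. There is a memoryless strategy σ for player j such that: (1) for every s ∈ A_j(G), every play from s compatible with σ has color sequence in Λ_j; (2) for every s ∈ W_j(G), every play from s compatible with σ has color sequence in Ω_j; and (3) for every s ∉ A_{1−j}(G), no play from s compatible with σ has color sequence in Λ_{1−j}. -/

import Mathlib

/-- A parity game: an owner (player `0` or `1`) for each state, a total
transition relation `R` and a coloring `c` of the states. -/
structure ParityGame (S : Type) where
  owner : S → Fin 2
  R : S → S → Prop
  total : ∀ s, ∃ t, R s t
  c : S → ℕ

namespace ParityGame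

variable {S : Type}

/-- The value `e` occurs infinitely often in the sequence `π`. -/
def InfOften (π : ℕ → ℕ) (e : ℕ) : Prop := ∀ n, ∃ i, n ≤ i ∧ π i = e

/-- `π ∈ Ω_j` : `π` is bounded and the largest value occurring infinitely often
in `π` is congruent to `j` mod 2. -/
def InOmega (j : Fin 2) (π : ℕ → ℕ) : Prop :=
  (∃ k, ∀ i, π i ≤ k) ∧
  ∃ e, InfOften π e ∧ (∀ e', InfOften π e' → e' ≤ e) ∧ e % 2 = (j : ℕ)

/-- `π ∈ Λ_j` : `π ∈ Ω_j` and the largest non-initial entry of `π` is congruent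
to `j` mod 2. -/
def InLambda (j : Fin 2) (π : ℕ → ℕ) : Prop :=
  InOmega j π ∧ ∃ i, 1 ≤ i ∧ (∀ k, 1 ≤ k → π k ≤ π i) ∧ π i % 2 = (j : ℕ)

variable (G : ParityGame S)

/-- A play: an infinite sequence of states respecting the transition relation. -/
def IsPlay (ρ : ℕ → S) : Prop := ∀ i, G.R (ρ i) (ρ (i + 1))

/-- A strategy is modelled as a function from (past history, current state) to a
successor of the current state. -/
def IsStrategy (σ : List S → S → S) : Prop := ∀ h s, G.R s (σ h s)

/-- A play is compatible with a strategy `σ` of player `j` if at every state owned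
by `j` the play follows `σ` (applied to the history so far). -/
def Compatible (j : Fin 2) (σ : List S → S → S) (ρ : ℕ → S) : Prop :=
  ∀ i, G.owner (ρ i) = j → ρ (i + 1) = σ (List.ofFn fun k : Fin i => ρ k.val) (ρ i)

/-- A strategy is memoryless if it only depends on the current state. -/
def Memoryless {S : Type} (σ : List S → S → S) : Prop := ∀ h h' s, σ h s = σ h' s

/-- The color sequence of a play. -/
def colorSeq (ρ : ℕ → S) : ℕ → ℕ := fun i => G.c (ρ i)

/-- The segment `ρ_a ρ_{a+1} ... ρ_b` is `j`-dominating: it has at least one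
transition and the largest color among its non-initial states is ≡ j (mod 2). -/
def SegDom (j : Fin 2) (ρ : ℕ → S) (a b : ℕ) : Prop :=
  a < b ∧ ((Finset.Icc (a + 1) b).sup fun k => G.c (ρ k)) % 2 = (j : ℕ)

/-- The play `ρ` begins with an infinite number of consecutive `j`-dominating
sequences. -/
def BeginsInfDom (j : Fin 2) (ρ : ℕ → S) : Prop :=
  ∃ idx : ℕ → ℕ, idx 0 = 0 ∧ ∀ ℓ, G.SegDom j ρ (idx ℓ) (idx (ℓ + 1))

/-- The play `ρ` begins with (at least) `k` consecutive `j`-dominating sequences. -/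
def BeginsKDom (j : Fin 2) (ρ : ℕ → S) (k : ℕ) : Prop :=
  ∃ idx : ℕ → ℕ, idx 0 = 0 ∧ ∀ ℓ < k, G.SegDom j ρ (idx ℓ) (idx (ℓ + 1))

/-- The (infinite) play `ρ` is itself `j`-dominating : the largest color among
its non-initial states is ≡ j (mod 2). -/
def PlayDom (j : Fin 2) (ρ : ℕ → S) : Prop :=
  ∃ i, 1 ≤ i ∧ (∀ k, 1 ≤ k → G.c (ρ k) ≤ G.c (ρ i)) ∧ G.c (ρ i) % 2 = (j : ℕ)

/-- The winning region `W_j(G)` of player `j`. -/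
def WinRegion (j : Fin 2) : Set S :=
  {s | ∃ σ, G.IsStrategy σ ∧ ∀ ρ, G.IsPlay ρ → ρ 0 = s → G.Compatible j σ ρ →
    InOmega j (G.colorSeq ρ)}

/-- The winning core `A_j(G)` of player `j`. -/
def WinCore (j : Fin 2) : Set S :=
  {s | ∃ σ, G.IsStrategy σ ∧ ∀ ρ, G.IsPlay ρ → ρ 0 = s → G.Compatible j σ ρ →
    G.BeginsInfDom j ρ}

/-- `A^k_j(G)` : states from which player `j` can ensure that the play begins
with at least `k` consecutive `j`-dominating sequences. -/
def WinCoreK (j : Fin 2) (k : ℕ) : Set S :=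
  {s | ∃ σ, G.IsStrategy σ ∧ ∀ ρ, G.IsPlay ρ → ρ 0 = s → G.Compatible j σ ρ →
    G.BeginsKDom j ρ k}

/-- The restricted parity game `G ↾ T` (given that the restricted transition
relation is total). -/
def restrict (T : Set S) (h : ∀ s : T, ∃ t : T, G.R s.1 t.1) : ParityGame T where
  owner s := G.owner s.1
  R a b := G.R a.1 b.1
  total := h
  c s := G.c s.1

end ParityGame

/-- Membership in the attractor `Attr_j(G, T)` : the least set containing `T`,
closed under adding states from which player `j` controls reaching it. -/
inductive ParityGame.AttrRel {S : Type} (G : ParityGame S) (j : Fin 2) (T : Set S) : S → Prop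
  | base {s} : s ∈ T → AttrRel G j T s
  | own {s t} : G.owner s = j → G.R s t → AttrRel G j T t → AttrRel G j T s
  | opp {s} : G.owner s ≠ j → (∀ t, G.R s t → AttrRel G j T t) → AttrRel G j T s

namespace ParityGame

variable {S : Type} (G : ParityGame S)

/-- The attractor `Attr_j(G, T)` as a set. -/
def attractor (j : Fin 2) (T : Set S) : Set S := {s | AttrRel G j T s}

/-- The positive attractor `Attr⁺_j(G, T)`. -/
def posAttractor (j : Fin 2) (T : Set S) : Set S :=
  G.attractor j ({s | G.owner s = j ∧ ∃ t ∈ T, G.R s t} ∪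
                 {s | G.owner s ≠ j ∧ ∀ t, G.R s t → t ∈ T})

/-- The product game `G†_j` over states `S × {0, ..., d}`. -/
def prodGame (j : Fin 2) (d : ℕ) (hc : ∀ s, G.c s ≤ d) :
    ParityGame (S × Fin (d + 1)) where
  owner p := G.owner p.1
  R p q := G.R p.1 q.1 ∧ (q.2 : ℕ) = max (p.2 : ℕ) (G.c q.1)
  total p := by
    obtain ⟨t, ht⟩ := G.total p.1
    refine ⟨(t, ⟨max (p.2 : ℕ) (G.c t), ?_⟩), ht, rfl⟩
    exact Nat.lt_succ_iff.mpr (max_le (Nat.lt_succ_iff.mp p.2.isLt) (hc t))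
  c p := if (p.2 : ℕ) % 2 = (j : ℕ) then G.c p.1 else (p.2 : ℕ)

/-- `X` is a fatal attractor for player `j`: all states in `X` have the same
color `e ≡ j (mod 2)` and from every state of `X` player `j` can force the play
back to `X` without passing a color greater than `e`. -/
def FatalAttractor (j : Fin 2) (X : Set S) : Prop :=
  ∃ e, e % 2 = (j : ℕ) ∧ (∀ s ∈ X, G.c s = e) ∧
    ∀ s ∈ X, ∃ σ, G.IsStrategy σ ∧ ∀ ρ, G.IsPlay ρ → ρ 0 = s → G.Compatible j σ ρ →
      ∃ k, 0 < k ∧ ρ k ∈ X ∧ ∀ i, 0 < i → i ≤ k → G.c (ρ i) ≤ e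

/-- `T` is `j`-closed: player `j` can force the play to stay in `T`. -/
def JClosed (j : Fin 2) (T : Set S) : Prop :=
  (∀ s ∈ T, G.owner s ≠ j → ∀ t, G.R s t → t ∈ T) ∧
  (∀ s ∈ T, G.owner s = j → ∃ t ∈ T, G.R s t)

/-- The restriction of `G` to a `j`-closed set has a total transition relation. -/
theorem JClosed.totalOn {G : ParityGame S} {j : Fin 2} {T : Set S}
    (h : G.JClosed j T) : ∀ s : T, ∃ t : T, G.R s.1 t.1 := by
  rintro ⟨s, hs⟩
  by_cases hj : G.owner s = j
  · obtain ⟨t, ht, hrt⟩ := h.2 s hs hj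
    exact ⟨⟨t, ht⟩, hrt⟩
  · obtain ⟨t, hrt⟩ := G.total s
    exact ⟨⟨t, h.1 s hs hj t hrt⟩, hrt⟩

end ParityGame

namespace ParityGame

/-- The sequence `B^i_j(G)` of under-approximations of the winning core. -/
def Bset {S : Type} (G : ParityGame S) (j : Fin 2) : ℕ → Set S
  | 0 => Set.univ
  | i + 1 =>
    {s | s ∈ Bset G j i ∧ ∃ σ, G.IsStrategy σ ∧ ∀ ρ, G.IsPlay ρ → ρ 0 = s →
      G.Compatible j σ ρ → ∃ k, G.SegDom j ρ 0 k ∧ ρ k ∈ Bset G j i}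

open Classical in
/-- Rank of a color sequence according to the order
`Λ₁ ◁ Ω₁ \ Λ₁ ◁ Ω₀ \ Λ₀ ◁ Λ₀`; the preference relation `≤₀` of player 0
compares these ranks. -/
noncomputable def prefRank (π : ℕ → ℕ) : ℕ :=
  if InLambda 0 π then 3
  else if InOmega 0 π then 2
  else if InLambda 1 π then 0
  else 1

/-- The reward order `≺_j` on colors. -/
def RewardLt (j : Fin 2) (v u : ℕ) : Prop :=
  (v < u ∧ u % 2 = (j : ℕ)) ∨ (u < v ∧ v % 2 = ((1 - j : Fin 2) : ℕ))

end ParityGame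

open ParityGame


namespace PGProof

open ParityGame

theorem fin2_cases (x j : Fin 2) : x = j ∨ x = 1 - j := by
  revert x j; decide
theorem fin2_ne (j : Fin 2) : j ≠ 1 - j := by
  revert j; decide
theorem fin2_inv (j : Fin 2) : 1 - (1 - j) = j := by
  revert j; decide
theorem fin2_val (j : Fin 2) : ((1 - j : Fin 2) : ℕ) = 1 - (j : ℕ) := by
  revert j; decide

noncomputable def Mx (π : ℕ → ℕ) : ℕ := sSup (Set.range fun i => π (i + 1))
noncomputable def Lx (π : ℕ → ℕ) : ℕ := sSup {e | InfOften π e}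

theorem Mx_spec {d : ℕ} {π : ℕ → ℕ} (h : ∀ i, π i ≤ d) :
    (∃ i, π (i + 1) = Mx π) ∧ ∀ i, π (i + 1) ≤ Mx π := by
  have hb : BddAbove (Set.range fun i => π (i + 1)) := by
    refine ⟨d, ?_⟩
    rintro _ ⟨i, rfl⟩
    exact h _
  have hne : (Set.range fun i => π (i + 1)).Nonempty := ⟨_, 0, rfl⟩
  refine ⟨?_, fun i => le_csSup hb ⟨i, rfl⟩⟩
  exact Nat.sSup_mem hne hb

theorem Mx_eq {d : ℕ} {π : ℕ → ℕ} (h : ∀ i, π i ≤ d) {m p : ℕ} (hp : 1 ≤ p) (hm : π p = m)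
    (hle : ∀ i, 1 ≤ i → π i ≤ m) : Mx π = m := by
  obtain ⟨⟨i, hi⟩, h2⟩ := Mx_spec h
  apply le_antisymm
  · rw [← hi]; exact hle _ (by omega)
  · have := h2 (p - 1)
    rwa [Nat.sub_add_cancel hp, hm] at this

theorem exists_infOften {d : ℕ} {π : ℕ → ℕ} (h : ∀ i, π i ≤ d) : ∃ e, InfOften π e := by
  by_contra hcon
  have h1 : ∀ e, ∃ n, ∀ i, n ≤ i → π i ≠ e := by
    intro e
    by_contra h2
    apply hcon
    refine ⟨e, fun n => ?_⟩
    by_contra h3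
    exact h2 ⟨n, fun i hi he => h3 ⟨i, hi, he⟩⟩
  choose N hN using h1
  have := hN (π ((Finset.range (d + 1)).sup N)) ((Finset.range (d + 1)).sup N)
    (Finset.le_sup (f := N) (Finset.mem_range.2 (Nat.lt_succ_of_le (h _))))
  exact this rfl

theorem infOften_le {d : ℕ} {π : ℕ → ℕ} (h : ∀ i, π i ≤ d) {e : ℕ} (he : InfOften π e) : e ≤ d := by
  obtain ⟨i, _, hi⟩ := he 0
  rw [← hi]; exact h i

theorem Lx_inf {d : ℕ} {π : ℕ → ℕ} (h : ∀ i, π i ≤ d) : InfOften π (Lx π) :=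
  Nat.sSup_mem (s := {e | InfOften π e}) (exists_infOften h) ⟨d, fun _ he => infOften_le h he⟩

theorem Lx_max {d : ℕ} {π : ℕ → ℕ} (h : ∀ i, π i ≤ d) {e : ℕ} (he : InfOften π e) : e ≤ Lx π :=
  le_csSup (s := {e | InfOften π e}) ⟨d, fun _ he => infOften_le h he⟩ he

theorem Lx_ev {d : ℕ} {π : ℕ → ℕ} (h : ∀ i, π i ≤ d) : ∃ N, ∀ i, N ≤ i → π i ≤ Lx π := by
  have h1 : ∀ e, ∃ n, Lx π < e → ∀ i, n ≤ i → π i ≠ e := by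
    intro e
    by_cases hlt : Lx π < e
    · by_contra h2
      have : InfOften π e := by
        intro n
        by_contra h3
        exact h2 ⟨n, fun _ i hi he => h3 ⟨i, hi, he⟩⟩
      have := Lx_max h this
      omega
    · exact ⟨0, fun h => absurd h hlt⟩
  choose N hN using h1
  refine ⟨(Finset.range (d + 1)).sup N, fun i hi => ?_⟩
  by_contra hcon
  refine hN (π i) (by omega) i (le_trans ?_ hi) rfl
  exact Finset.le_sup (f := N) (Finset.mem_range.2 (Nat.lt_succ_of_le (h _)))

theorem Lx_eq {d : ℕ} {π : ℕ → ℕ} (h : ∀ i, π i ≤ d) {e N : ℕ} (he : InfOften π e)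
    (hN : ∀ i, N ≤ i → π i ≤ e) : Lx π = e := by
  apply le_antisymm
  · obtain ⟨i, hi, h2⟩ := Lx_inf h N
    rw [← h2]; exact hN i hi
  · exact Lx_max h he

theorem Lx_shift {d : ℕ} {π : ℕ → ℕ} (h : ∀ i, π i ≤ d) (k : ℕ) :
    Lx (fun i => π (k + i)) = Lx π := by
  obtain ⟨N, hN⟩ := Lx_ev h
  refine Lx_eq (d := d) (N := N) (fun i => h _) ?_ (fun i hi => hN _ (by omega))
  intro n
  obtain ⟨i, hi, h2⟩ := Lx_inf h (n + k)
  refine ⟨i - k, by omega, ?_⟩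
  have : k + (i - k) = i := by omega
  simp only [this, h2]

theorem Lx_le_Mx {d : ℕ} {π : ℕ → ℕ} (h : ∀ i, π i ≤ d) : Lx π ≤ Mx π := by
  obtain ⟨i, hi, h2⟩ := Lx_inf h 1
  rw [← h2]
  have := (Mx_spec h).2 (i - 1)
  rwa [Nat.sub_add_cancel hi] at this

theorem Mx_le {d : ℕ} {π : ℕ → ℕ} (h : ∀ i, π i ≤ d) : Mx π ≤ d := by
  obtain ⟨⟨i, hi⟩, _⟩ := Mx_spec h
  rw [← hi]; exact h _

theorem Mx_step {d : ℕ} {π : ℕ → ℕ} (h : ∀ i, π i ≤ d) :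
    Mx π = max (π 1) (Mx (fun i => π (i + 1))) := by
  obtain ⟨⟨i, hi⟩, h2⟩ := Mx_spec h
  obtain ⟨⟨i', hi'⟩, h2'⟩ := Mx_spec (π := fun i => π (i + 1)) (d := d) (fun i => h _)
  apply le_antisymm
  · rw [← hi]
    rcases i with _ | i
    · exact le_max_left _ _
    · exact le_max_of_le_right (h2' i)
  · apply max_le
    · exact h2 0
    · rw [← hi']; exact h2 _

/-- sign of a color for player `j` -/
def sg (j : Fin 2) (m : ℕ) : ℤ := if m % 2 = (j : ℕ) then 1 else -1

theorem sg_opp (j : Fin 2) (m : ℕ) : sg (1 - j) m = - sg j m := by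
  have := fin2_val j
  have := j.isLt
  unfold sg
  split_ifs <;> omega

theorem sg_cases (j : Fin 2) (m : ℕ) : sg j m = 1 ∨ sg j m = -1 := by
  unfold sg
  split_ifs <;> simp

noncomputable def fv (d : ℕ) (j : Fin 2) (π : ℕ → ℕ) : ℤ :=
  sg j (Lx π) * (d + 2) + sg j (Mx π) * (Mx π + 1)

theorem fv_opp (d : ℕ) (j : Fin 2) (π : ℕ → ℕ) : fv d (1 - j) π = - fv d j π := by
  unfold fv
  rw [sg_opp, sg_opp]; ring

theorem fv_step {d : ℕ} {j : Fin 2} {π π' : ℕ → ℕ} (h : ∀ i, π i ≤ d) (h' : ∀ i, π' i ≤ d)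
    (h1 : π 1 = π' 1) (hle : fv d j (fun i => π (i + 1)) ≤ fv d j (fun i => π' (i + 1))) :
    fv d j π ≤ fv d j π' := by
  have e1 := Lx_shift h 1
  have e2 := Lx_shift h' 1
  have e1' : Lx (fun i => π (i + 1)) = Lx π := by simpa only [add_comm] using e1
  have e2' : Lx (fun i => π' (i + 1)) = Lx π' := by simpa only [add_comm] using e2
  have m1 := Mx_step h
  have m2 := Mx_step h'
  have b1 := Mx_le (π := fun i => π (i + 1)) (d := d) (fun i => h _)
  have b2 := Mx_le (π := fun i => π' (i + 1)) (d := d) (fun i => h' _)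
  have b3 := h 1
  unfold fv at *
  rw [e1', e2'] at hle
  rw [m1, m2, ← h1]
  generalize Mx (fun i => π (i + 1)) = A at *
  generalize Mx (fun i => π' (i + 1)) = B at *
  generalize π 1 = C at *
  have hs : sg j (Lx π) = 1 ∨ sg j (Lx π) = -1 := sg_cases _ _
  have hs' : sg j (Lx π') = 1 ∨ sg j (Lx π') = -1 := sg_cases _ _
  generalize sg j (Lx π) = x at *
  generalize sg j (Lx π') = y at *
  clear e1 e2 e1' e2' m1 m2 h1 h h'
  rcases le_total C A with hA | hA <;> rcases le_total C B with hB | hB <;>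
    simp only [max_eq_left, max_eq_right, hA, hB] <;>
    unfold sg at * <;> rcases hs with rfl | rfl <;> rcases hs' with rfl | rfl <;>
    split_ifs at * <;> omega

/-- cycle value -/
def cyc (d : ℕ) (j : Fin 2) (m : ℕ) : ℤ := sg j m * (d + 2) + sg j m * (m + 1)

theorem inOmega_iff {d : ℕ} {j : Fin 2} {π : ℕ → ℕ} (h : ∀ i, π i ≤ d) :
    InOmega j π ↔ Lx π % 2 = (j : ℕ) := by
  constructor
  · rintro ⟨_, e, he, hm, hj⟩
    have : Lx π = e := le_antisymm (hm _ (Lx_inf h)) (Lx_max h he)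
    rw [this, hj]
  · intro hj
    exact ⟨⟨d, h⟩, Lx π, Lx_inf h, fun e' he' => Lx_max h he', hj⟩

theorem inLambda_iff {d : ℕ} {j : Fin 2} {π : ℕ → ℕ} (h : ∀ i, π i ≤ d) :
    InLambda j π ↔ Lx π % 2 = (j : ℕ) ∧ Mx π % 2 = (j : ℕ) := by
  unfold InLambda
  rw [inOmega_iff h]
  constructor
  · rintro ⟨h1, i, hi, hm, hj⟩
    refine ⟨h1, ?_⟩
    rw [Mx_eq h hi rfl hm, hj]
  · rintro ⟨h1, h2⟩
    obtain ⟨⟨i, hi⟩, hm⟩ := Mx_spec h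
    refine ⟨h1, i + 1, by omega, ?_, by rw [hi, h2]⟩
    intro k hk
    have := hm (k - 1)
    rwa [Nat.sub_add_cancel hk, ← hi] at this

theorem inOmega_fv {d : ℕ} {j : Fin 2} {π : ℕ → ℕ} (h : ∀ i, π i ≤ d) :
    InOmega j π ↔ 0 < fv d j π := by
  rw [inOmega_iff h]
  have := Mx_le h
  unfold fv sg
  split_ifs <;> constructor <;> intros <;> omega

theorem inLambda_fv {d : ℕ} {j : Fin 2} {π : ℕ → ℕ} (h : ∀ i, π i ≤ d) :
    InLambda j π ↔ (d : ℤ) + 2 < fv d j π := by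
  rw [inLambda_iff h]
  have := Mx_le h
  unfold fv sg
  split_ifs <;> constructor <;> intros <;> omega

variable {S : Type}

theorem seg_sup (G : ParityGame S) (ρ : ℕ → S) {a b p m : ℕ} (h1 : a < p) (h2 : p ≤ b)
    (hm : G.c (ρ p) = m) (hle : ∀ i, a < i → i ≤ b → G.c (ρ i) ≤ m) :
    ((Finset.Icc (a + 1) b).sup fun k => G.c (ρ k)) = m := by
  apply le_antisymm
  · apply Finset.sup_le
    intro k hk
    rw [Finset.mem_Icc] at hk
    exact hle k (by omega) hk.2
  · rw [← hm]
    exact Finset.le_sup (f := fun k => G.c (ρ k)) (Finset.mem_Icc.2 ⟨by omega, h2⟩)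

theorem exists_seg (idx : ℕ → ℕ) (h0 : idx 0 = 0) (hlt : ∀ l, idx l < idx (l + 1)) (p : ℕ)
    (hp : 0 < p) : ∃ l, idx l < p ∧ p ≤ idx (l + 1) := by
  have hmono : StrictMono idx := strictMono_nat_of_lt_succ hlt
  have hex : ∃ l, p ≤ idx l := ⟨p, hmono.le_apply⟩
  classical
  have h1 := Nat.find_spec hex
  have h2 : Nat.find hex ≠ 0 := by
    intro h
    rw [h, h0] at h1
    omega
  obtain ⟨l, hl⟩ := Nat.exists_eq_succ_of_ne_zero h2
  refine ⟨l, ?_, ?_⟩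
  · have := Nat.find_min hex (m := l) (by omega)
    omega
  · rw [hl] at h1; exact h1

theorem beginsInfDom_iff (G : ParityGame S) {d : ℕ} (hd : ∀ s, G.c s ≤ d) (j : Fin 2) (ρ : ℕ → S) :
    G.BeginsInfDom j ρ ↔ InLambda j (G.colorSeq ρ) := by
  have h : ∀ i, G.colorSeq ρ i ≤ d := fun i => hd _
  rw [inLambda_iff h]
  constructor
  · rintro ⟨idx, h0, hs⟩
    have hlt : ∀ l, idx l < idx (l + 1) := fun l => (hs l).1
    have hmono : StrictMono idx := strictMono_nat_of_lt_succ hlt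
    constructor
    · obtain ⟨N, hN⟩ := Lx_ev h
      obtain ⟨p, hp, he⟩ := Lx_inf h (idx N + 1)
      obtain ⟨l, hl1, hl2⟩ := exists_seg idx h0 hlt p (by omega)
      have h3 : N < l + 1 := hmono.lt_iff_lt.1 (show idx N < idx (l + 1) by omega)
      have h4 : N ≤ idx l := le_trans (by omega : N ≤ l) hmono.le_apply
      rw [← seg_sup G ρ hl1 hl2 he (fun i hi _ => hN i (by omega))]
      exact (hs l).2
    · obtain ⟨⟨i, hi⟩, hm⟩ := Mx_spec h
      obtain ⟨l, hl1, hl2⟩ := exists_seg idx h0 hlt (i + 1) (by omega)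
      rw [← seg_sup G ρ hl1 hl2 hi (fun k hk _ => by
        have := hm (k - 1)
        rwa [Nat.sub_add_cancel (by omega)] at this)]
      exact (hs l).2
  · rintro ⟨h1, h2⟩
    obtain ⟨N, hN⟩ := Lx_ev h
    obtain ⟨⟨i, hi⟩, hm⟩ := Mx_spec h
    have hinf := Lx_inf h
    choose nx hnx1 hnx2 using hinf
    let idx : ℕ → ℕ := fun n => Nat.rec 0 (fun n r => if n = 0 then max N (i + 1) else nx (r + 1)) n
    have hi0 : idx 0 = 0 := rfl
    have hi1 : idx (0 + 1) = max N (i + 1) := rfl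
    have hi2 : ∀ n, idx (n + 1 + 1) = nx (idx (n + 1) + 1) := fun n => rfl
    have hge : ∀ n, N ≤ idx (n + 1) := by
      intro n
      induction n with
      | zero => rw [hi1]; exact le_max_left _ _
      | succ n ih => rw [hi2]; have := hnx1 (idx (n + 1) + 1); omega
    refine ⟨idx, hi0, ?_⟩
    intro l
    rcases l with _ | l
    · refine ⟨by rw [hi0, hi1]; omega, ?_⟩
      rw [seg_sup G ρ (p := i + 1) (m := Mx (G.colorSeq ρ)) (by omega) (by rw [hi1]; omega) hi, h2]
      intro k hk _
      have := hm (k - 1)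
      rwa [Nat.sub_add_cancel (by omega)] at this
    · have e := hi2 l
      have e2 := hnx1 (idx (l + 1) + 1)
      refine ⟨by omega, ?_⟩
      rw [seg_sup G ρ (p := idx (l + 1 + 1)) (m := Lx (G.colorSeq ρ)) (by omega) (by omega)
        (by rw [e]; exact hnx2 _), h1]
      intro k hk _
      exact hN k (by have := hge l; omega)

theorem exists_play (G : ParityGame S) (F : List S → S → S) (hF : G.IsStrategy F) (s : S) :
    ∃ ρ : ℕ → S, ρ 0 = s ∧ G.IsPlay ρ ∧
      ∀ i, ρ (i + 1) = F (List.ofFn fun k : Fin i => ρ k.val) (ρ i) := by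
  let H : ℕ → List S × S := fun n => Nat.rec ([], s) (fun _ x => (x.1 ++ [x.2], F x.1 x.2)) n
  have hH : ∀ n, H (n + 1) = ((H n).1 ++ [(H n).2], F (H n).1 (H n).2) := fun n => rfl
  have hl : ∀ n, (H n).1 = List.ofFn fun k : Fin n => (H k.val).2 := by
    intro n
    induction n with
    | zero => simp [H]
    | succ n ih =>
      rw [hH, List.ofFn_succ', List.concat_eq_append]
      simp [ih]
  have hs : ∀ i, (H (i + 1)).2 = F (List.ofFn fun k : Fin i => (H k.val).2) (H i).2 := by
    intro i
    rw [hH, ← hl]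
  refine ⟨fun n => (H n).2, rfl, ?_, hs⟩
  intro i
  show G.R (H i).2 (H (i + 1)).2
  rw [hs]
  exact hF _ _

def Fol (G : ParityGame S) (j : Fin 2) (σ : S → S) (ρ : ℕ → S) : Prop :=
  ∀ i, G.owner (ρ i) = j → ρ (i + 1) = σ (ρ i)

def Opt (d : ℕ) (G : ParityGame S) (j : Fin 2) (σ : S → S) (v : S → ℤ) : Prop :=
  (∀ u, G.R u (σ u)) ∧
  (∀ ρ, G.IsPlay ρ → Fol G j σ ρ → v (ρ 0) ≤ fv d j (G.colorSeq ρ)) ∧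
  (∀ ρ, G.IsPlay ρ → Fol G (1 - j) σ ρ → fv d j (G.colorSeq ρ) ≤ v (ρ 0))

theorem Opt.opp {d : ℕ} {G : ParityGame S} {j : Fin 2} {σ : S → S} {v : S → ℤ}
    (h : Opt d G j σ v) : Opt d G (1 - j) σ (fun s => - v s) := by
  refine ⟨h.1, fun ρ hp hf => ?_, fun ρ hp hf => ?_⟩
  · rw [fv_opp]; have := h.2.2 ρ hp hf; simpa using this
  · rw [fv_opp]; rw [fin2_inv] at hf; have := h.2.1 ρ hp hf; simpa using this

def Half (d : ℕ) (G : ParityGame S) (j : Fin 2) : Prop :=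
  ∃ (σ : S → S) (v : S → ℤ) (g : List S → S → S), (∀ u, G.R u (σ u)) ∧ G.IsStrategy g ∧
  (∀ ρ, G.IsPlay ρ → Fol G j σ ρ → v (ρ 0) ≤ fv d j (G.colorSeq ρ)) ∧
  (∀ ρ, G.IsPlay ρ → G.Compatible (1 - j) g ρ → fv d j (G.colorSeq ρ) ≤ v (ρ 0))

/-- restrict the moves at `s` -/
def cut (G : ParityGame S) (s : S) (Q : S → Prop) (h : ∃ t, G.R s t ∧ Q t) : ParityGame S where
  owner := G.owner
  R u t := G.R u t ∧ (u = s → Q t)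
  total u := by
    by_cases hu : u = s
    · obtain ⟨t, ht, hq⟩ := h
      exact ⟨t, hu ▸ ht, fun _ => hq⟩
    · obtain ⟨t, ht⟩ := G.total u
      exact ⟨t, ht, fun h => absurd h hu⟩
  c := G.c

/-- value of a periodic play -/
theorem periodic {d : ℕ} {H : ParityGame S} (hd : ∀ s, H.c s ≤ d) {j : Fin 2} {σ : S → S}
    {v : S → ℤ} (ho : Opt d H j σ v) {ρ : ℕ → S} {a n : ℕ} (hn : 0 < n)
    (hR : ∀ r, r < n → H.R (ρ (a + r)) (ρ (a + r + 1)))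
    (hF : ∀ r, r < n → H.owner (ρ (a + r)) = 1 - j → ρ (a + r + 1) = σ (ρ (a + r)))
    (hc : ρ (a + n) = ρ a) {p m : ℕ} (hp1 : a < p) (hp2 : p ≤ a + n) (hm : H.c (ρ p) = m)
    (hle : ∀ i, a < i → i ≤ a + n → H.c (ρ i) ≤ m) : cyc d j m ≤ v (ρ a) := by
  have hsucc : ∀ i, ρ (a + (i + 1) % n) = ρ (a + i % n + 1) := by
    intro i
    have hlt := Nat.mod_lt i hn
    by_cases h : i % n + 1 = n
    · have h1 : (i + 1) % n = 0 := by
        rw [Nat.add_mod]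
        by_cases h2 : n = 1
        · subst h2; omega
        · rw [Nat.mod_eq_of_lt (by omega : 1 < n), h, Nat.mod_self]
      rw [h1, add_assoc, h, hc, add_zero]
    · have h1 : (i + 1) % n = i % n + 1 := by
        rw [Nat.add_mod, Nat.mod_eq_of_lt (by omega : 1 < n), Nat.mod_eq_of_lt (by omega)]
      rw [h1, add_assoc]
  let ρ' : ℕ → S := fun i => ρ (a + i % n)
  have hplay : H.IsPlay ρ' := by
    intro i
    show H.R (ρ (a + i % n)) (ρ (a + (i + 1) % n))
    rw [hsucc]
    exact hR _ (Nat.mod_lt i hn)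
  have hfol : Fol H (1 - j) σ ρ' := by
    intro i hi
    show ρ (a + (i + 1) % n) = _
    rw [hsucc]
    exact hF _ (Nat.mod_lt i hn) hi
  have key := ho.2.2 ρ' hplay hfol
  have hb : ∀ i, H.colorSeq ρ' i ≤ d := fun i => hd _
  have hall : ∀ i, H.colorSeq ρ' i ≤ m := by
    intro i
    show H.c (ρ (a + i % n)) ≤ m
    have hlt := Nat.mod_lt i hn
    by_cases h0 : i % n = 0
    · rw [h0, add_zero, ← hc]; exact hle _ (by omega) (by omega)
    · exact hle _ (by omega) (by omega)
  have hat : ∀ k, H.colorSeq ρ' (k * n + (p - a)) = m := by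
    intro k
    show H.c (ρ (a + (k * n + (p - a)) % n)) = m
    rw [mul_comm, Nat.mul_add_mod]
    by_cases h0 : p - a = n
    · rw [h0, Nat.mod_self, add_zero, ← hc, ← h0, Nat.add_sub_cancel' hp1.le, hm]
    · rw [Nat.mod_eq_of_lt (by omega), Nat.add_sub_cancel' hp1.le, hm]
  have hL : Lx (H.colorSeq ρ') = m := by
    refine Lx_eq (N := 0) hb ?_ (fun i _ => hall i)
    intro N
    exact ⟨N * n + (p - a), by nlinarith [Nat.zero_le (p - a)], hat N⟩
  have hM : Mx (H.colorSeq ρ') = m := Mx_eq hb (p := 0 * n + (p - a)) (by omega) (hat 0) (fun i _ => hall i)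
  have h0 : ρ' 0 = ρ a := by simp [ρ']
  rw [h0] at key
  unfold fv at key
  rw [hL, hM] at key
  exact key

/-- plays that follow `σ2` or `σ1` according to the bit `b` -/
structure Mixed (G : ParityGame S) (j : Fin 2) (s : S) (Q1 : S → Prop) (σ1 σ2 : S → S)
    (ρ : ℕ → S) (b : ℕ → Prop) : Prop where
  play : G.IsPlay ρ
  hb : ∀ i, ρ i = s → (b (i + 1) ↔ ¬ Q1 (ρ (i + 1)))
  hb' : ∀ i, ρ i ≠ s → (b (i + 1) ↔ b i)
  f2 : ∀ i, G.owner (ρ i) = 1 - j → b i → ρ (i + 1) = σ2 (ρ i)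
  f1 : ∀ i, G.owner (ρ i) = 1 - j → ¬ b i → ρ (i + 1) = σ1 (ρ i)

theorem Mixed.shift {G : ParityGame S} {j : Fin 2} {s : S} {Q1 : S → Prop} {σ1 σ2 : S → S}
    {ρ : ℕ → S} {b : ℕ → Prop} (h : Mixed G j s Q1 σ1 σ2 ρ b) :
    Mixed G j s Q1 σ1 σ2 (fun i => ρ (i + 1)) (fun i => b (i + 1)) :=
  ⟨fun i => h.play (i + 1), fun i => h.hb (i + 1), fun i => h.hb' (i + 1),
    fun i => h.f2 (i + 1), fun i => h.f1 (i + 1)⟩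

theorem Mixed.bit {G : ParityGame S} {j : Fin 2} {s : S} {Q1 : S → Prop} {σ1 σ2 : S → S}
    {ρ : ℕ → S} {b : ℕ → Prop} (h : Mixed G j s Q1 σ1 σ2 ρ b) (a r : ℕ)
    (hr : ∀ i, a < i → i ≤ a + r → ρ i ≠ s) : b (a + r + 1) ↔ b (a + 1) := by
  induction r with
  | zero => rfl
  | succ r ih =>
    rw [← ih (fun i h1 h2 => hr i h1 (by omega))]
    exact h.hb' _ (hr _ (by omega) (by omega))

section key

variable {G : ParityGame S} {j : Fin 2} {s : S} {Q1 Q2 : S → Prop} {σ1 σ2 : S → S}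
    {v1 v2 : S → ℤ} {d : ℕ}

theorem Mixed.seg (hs : G.owner s = j)
    (hQ : ∀ t, G.R s t → Q1 t ∨ Q2 t) (hQ1 : ∃ t, G.R s t ∧ Q1 t) (hQ2 : ∃ t, G.R s t ∧ Q2 t)
    (o1 : Opt d (cut G s Q1 hQ1) j σ1 v1) (o2 : Opt d (cut G s Q2 hQ2) j σ2 v2)
    (hv : v2 s ≤ v1 s) {ρ : ℕ → S} {b : ℕ → Prop}
    (h : Mixed G j s Q1 σ1 σ2 ρ b) (a : ℕ) (ha : ρ a = s) :
    ∃ (H : ParityGame S) (σ : S → S) (v : S → ℤ), H.owner = G.owner ∧ H.c = G.c ∧ Opt d H j σ v ∧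
      v s ≤ v1 s ∧
      ∀ r, (∀ i, a < i → i ≤ a + r → ρ i ≠ s) →
        H.R (ρ (a + r)) (ρ (a + r + 1)) ∧
        (H.owner (ρ (a + r)) = 1 - j → ρ (a + r + 1) = σ (ρ (a + r))) := by
  have hns : ∀ i, G.owner (ρ i) = 1 - j → ρ i ≠ s := by
    intro i h1 h2
    rw [h2, hs] at h1
    exact fin2_ne j h1
  have hbit : ∀ r, (∀ i, a < i → i ≤ a + r → ρ i ≠ s) → ρ (a + r) ≠ s → (b (a + r) ↔ b (a + 1)) := by
    intro r hr hne
    rcases r with _ | r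
    · exact absurd ha hne
    · exact h.bit a r (fun i h1 h2 => hr i h1 (by omega))
  have hzero : ∀ r, (∀ i, a < i → i ≤ a + r → ρ i ≠ s) → ρ (a + r) = s → r = 0 := by
    intro r hr he
    by_contra h0
    exact hr (a + r) (by omega) le_rfl he
  by_cases hb : b (a + 1)
  · refine ⟨cut G s Q2 hQ2, σ2, v2, rfl, rfl, o2, hv, fun r hr => ⟨⟨h.play _, fun he => ?_⟩, fun hw => ?_⟩⟩
    · have := hzero r hr he
      subst this
      have h2 := (h.hb a ha).1 hb
      have h3 := h.play a
      rw [ha] at h3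
      exact (hQ _ h3).resolve_left h2
    · exact h.f2 _ hw ((hbit r hr (hns _ hw)).2 hb)
  · refine ⟨cut G s Q1 hQ1, σ1, v1, rfl, rfl, o1, le_rfl, fun r hr => ⟨⟨h.play _, fun he => ?_⟩, fun hw => ?_⟩⟩
    · have := hzero r hr he
      subst this
      by_contra h2
      exact hb ((h.hb a ha).2 h2)
    · exact h.f1 _ hw (fun h' => hb ((hbit r hr (hns _ hw)).1 h'))

theorem Mixed.cycle (hd : ∀ s, G.c s ≤ d) (hs : G.owner s = j)
    (hQ : ∀ t, G.R s t → Q1 t ∨ Q2 t) (hQ1 : ∃ t, G.R s t ∧ Q1 t) (hQ2 : ∃ t, G.R s t ∧ Q2 t)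
    (o1 : Opt d (cut G s Q1 hQ1) j σ1 v1) (o2 : Opt d (cut G s Q2 hQ2) j σ2 v2)
    (hv : v2 s ≤ v1 s) {ρ : ℕ → S} {b : ℕ → Prop}
    (h : Mixed G j s Q1 σ1 σ2 ρ b) {p q m N : ℕ} (hq : N < p) (h0 : ρ N = s) (hpq : p ≤ q)
    (hqs : ρ q = s) (hm : G.c (ρ p) = m) (hle : ∀ i, N < i → G.c (ρ i) ≤ m) :
    cyc d j m ≤ v1 s := by
  classical
  -- last visit before `p`
  obtain ⟨a, haN, hap, ha, hlast⟩ : ∃ a, N ≤ a ∧ a < p ∧ ρ a = s ∧ ∀ i, a < i → i < p → ρ i ≠ s := by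
    have h1 := Nat.findGreatest_spec (P := fun i => ρ i = s) (n := p - 1) (m := N) (by omega) h0
    have h2 := Nat.le_findGreatest (P := fun i => ρ i = s) (n := p - 1) (m := N) (by omega) h0
    have h3 := Nat.findGreatest_le (P := fun i => ρ i = s) (p - 1)
    refine ⟨_, h2, by omega, h1, fun i hi hi2 => ?_⟩
    exact Nat.findGreatest_is_greatest hi (by omega)
  obtain ⟨e, hpe, he, hfirst⟩ : ∃ e, p ≤ e ∧ ρ e = s ∧ ∀ i, p ≤ i → i < e → ρ i ≠ s := by
    have hex : ∃ e, p ≤ e ∧ ρ e = s := ⟨q, hpq, hqs⟩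
    refine ⟨Nat.find hex, (Nat.find_spec hex).1, (Nat.find_spec hex).2, fun i hi hi2 hc => ?_⟩
    exact Nat.find_min hex hi2 ⟨hi, hc⟩
  obtain ⟨H, σ, v, hw, hcc, ho, hvv, hr⟩ := h.seg hs hQ hQ1 hQ2 o1 o2 hv a ha
  have hno : ∀ i, a < i → i < e → ρ i ≠ s := by
    intro i h1 h2
    by_cases h3 : i < p
    · exact hlast i h1 h3
    · exact hfirst i (by omega) h2
  have hae : a + (e - a) = e := by omega
  have := periodic (H := H) (by rw [hcc]; exact hd) ho (ρ := ρ) (a := a) (n := e - a) (m := m) (by omega)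
    (fun r hrn => (hr r (fun i h1 h2 => hno i h1 (by omega))).1)
    (fun r hrn => (hr r (fun i h1 h2 => hno i h1 (by omega))).2)
    (by rw [hae, he, ha]) hap (by omega) (by rw [hcc]; exact hm)
    (fun i h1 _ => by rw [hcc]; exact hle i (by omega))
  rw [ha] at this
  exact this.trans hvv

theorem Mixed.fromPivot (hd : ∀ s, G.c s ≤ d) (hs : G.owner s = j)
    (hQ : ∀ t, G.R s t → Q1 t ∨ Q2 t) (hQ1 : ∃ t, G.R s t ∧ Q1 t) (hQ2 : ∃ t, G.R s t ∧ Q2 t)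
    (o1 : Opt d (cut G s Q1 hQ1) j σ1 v1) (o2 : Opt d (cut G s Q2 hQ2) j σ2 v2)
    (hv : v2 s ≤ v1 s) {ρ : ℕ → S} {b : ℕ → Prop}
    (h : Mixed G j s Q1 σ1 σ2 ρ b) (h0 : ρ 0 = s) : fv d j (G.colorSeq ρ) ≤ v1 s := by
  classical
  have hb : ∀ i, G.colorSeq ρ i ≤ d := fun i => hd _
  obtain ⟨⟨p, hp⟩, hm⟩ := Mx_spec hb
  have hm' : ∀ i, 0 < i → G.c (ρ i) ≤ Mx (G.colorSeq ρ) := fun i hi => by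
    have := hm (i - 1)
    rwa [Nat.sub_add_cancel hi] at this
  have hLM := Lx_le_Mx hb
  have hMd := Mx_le hb
  by_cases hinf : ∀ n, ∃ i, n ≤ i ∧ ρ i = s
  · have c1 : cyc d j (Mx (G.colorSeq ρ)) ≤ v1 s := by
      obtain ⟨q, hq, hqs⟩ := hinf (p + 1)
      exact h.cycle hd hs hQ hQ1 hQ2 o1 o2 hv (Nat.succ_pos p) h0 hq hqs hp hm'
    have c2 : cyc d j (Lx (G.colorSeq ρ)) ≤ v1 s := by
      obtain ⟨N, hN⟩ := Lx_ev hb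
      obtain ⟨N', hN', hs'⟩ := hinf N
      obtain ⟨e, he, hee⟩ := Lx_inf hb (N' + 1)
      obtain ⟨q, hq, hqs⟩ := hinf e
      exact h.cycle hd hs hQ hQ1 hQ2 o1 o2 hv he hs' hq hqs hee (fun i hi => hN i (by omega))
    unfold fv
    unfold cyc sg at *
    split_ifs at * <;> omega
  · obtain ⟨n, hn⟩ : ∃ n, ∀ i, n ≤ i → ρ i ≠ s := by
      by_contra hcon
      apply hinf
      intro n
      by_contra h3
      exact hcon ⟨n, fun i hi he => h3 ⟨i, hi, he⟩⟩
    obtain ⟨k, hk, hlast⟩ : ∃ k, ρ k = s ∧ ∀ i, k < i → ρ i ≠ s := by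
      have h1 := Nat.findGreatest_spec (P := fun i => ρ i = s) (n := n) (m := 0) (by omega) h0
      refine ⟨_, h1, fun i hi => ?_⟩
      by_cases hin : i ≤ n
      · exact Nat.findGreatest_is_greatest hi hin
      · exact hn i (by omega)
    obtain ⟨H, σ, v, hw, hcc, ho, hvv, hr⟩ := h.seg hs hQ hQ1 hQ2 o1 o2 hv k hk
    have htail := ho.2.2 (fun i => ρ (k + i)) (fun r => (hr r (fun i h1 _ => hlast i h1)).1)
      (fun r => (hr r (fun i h1 _ => hlast i h1)).2)
    have hcs : H.colorSeq (fun i => ρ (k + i)) = fun i => G.colorSeq ρ (k + i) := by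
      funext i; simp only [ParityGame.colorSeq, hcc]
    rw [hcs] at htail
    simp only [add_zero, hk] at htail
    have hb' : ∀ i, G.colorSeq ρ (k + i) ≤ d := fun i => hd _
    obtain ⟨⟨p', hp'⟩, hmm⟩ := Mx_spec hb'
    have hLs := Lx_shift hb k
    have hle : Mx (fun i => G.colorSeq ρ (k + i)) ≤ Mx (G.colorSeq ρ) := by
      rw [← hp']; exact hm' _ (by omega)
    have hor : Mx (G.colorSeq ρ) = Mx (fun i => G.colorSeq ρ (k + i)) ∨
        cyc d j (Mx (G.colorSeq ρ)) ≤ v1 s := by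
      by_cases hpk : k < p + 1
      · left
        apply le_antisymm _ hle
        rw [← hp]
        have := hmm (p - k)
        have e : k + (p - k + 1) = p + 1 := by omega
        rwa [e] at this
      · right
        exact h.cycle hd hs hQ hQ1 hQ2 o1 o2 hv (Nat.succ_pos p) h0 (not_lt.1 hpk) hk hp hm'
    unfold fv at *
    rw [hLs] at htail
    generalize Mx (fun i => G.colorSeq ρ (k + i)) = A at *
    generalize Mx (G.colorSeq ρ) = B at *
    rcases hor with rfl | hor
    · omega
    · unfold cyc sg at *
      split_ifs at * <;> omega

/-- one step of optimal values -/
theorem Opt.edge {H : ParityGame S} {σ : S → S} {v : S → ℤ} (hd : ∀ s, H.c s ≤ d)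
    (ho : Opt d H j σ v) {ρ : ℕ → S} (hR : H.R (ρ 0) (ρ 1))
    (hF : H.owner (ρ 0) = 1 - j → ρ 1 = σ (ρ 0))
    (hle : fv d j (H.colorSeq (fun i => ρ (i + 1))) ≤ v (ρ 1)) :
    fv d j (H.colorSeq ρ) ≤ v (ρ 0) := by
  let π : ℕ → S := fun n => σ^[n] (ρ 1)
  have hπ : ∀ n, π (n + 1) = σ (π n) := fun n => Function.iterate_succ_apply' σ n _
  have hv := ho.2.1 π (fun i => by rw [hπ]; exact ho.1 _) (fun i _ => hπ i)
  let ρ' : ℕ → S := fun n => Nat.casesOn n (ρ 0) π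
  have h2 := ho.2.2 ρ' (fun i => by
      rcases i with _ | i
      · exact hR
      · show H.R (π i) (π (i + 1))
        rw [hπ]; exact ho.1 _) (fun i hi => by
      rcases i with _ | i
      · exact hF hi
      · exact hπ i)
  refine le_trans ?_ h2
  exact fv_step (fun i => hd _) (fun i => hd _) rfl (hle.trans hv)

theorem Mixed.main (hd : ∀ s, G.c s ≤ d) (hs : G.owner s = j)
    (hQ : ∀ t, G.R s t → Q1 t ∨ Q2 t) (hQ1 : ∃ t, G.R s t ∧ Q1 t) (hQ2 : ∃ t, G.R s t ∧ Q2 t)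
    (o1 : Opt d (cut G s Q1 hQ1) j σ1 v1) (o2 : Opt d (cut G s Q2 hQ2) j σ2 v2)
    (hv : v2 s ≤ v1 s) {ρ : ℕ → S} {b : ℕ → Prop}
    (h : Mixed G j s Q1 σ1 σ2 ρ b) (h0 : ¬ b 0) : fv d j (G.colorSeq ρ) ≤ v1 (ρ 0) := by
  by_cases hvis : ∃ k, ρ k = s
  · obtain ⟨k, hk⟩ := hvis
    induction k generalizing ρ b with
    | zero =>
      rw [hk]
      exact h.fromPivot hd hs hQ hQ1 hQ2 o1 o2 hv hk
    | succ k ih =>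
      by_cases hk0 : ρ 0 = s
      · rw [hk0]
        exact h.fromPivot hd hs hQ hQ1 hQ2 o1 o2 hv hk0
      · have := ih h.shift (fun hb => h0 ((h.hb' 0 hk0).1 hb)) hk
        exact Opt.edge (H := cut G s Q1 hQ1) hd o1 ⟨h.play 0, fun he => absurd he hk0⟩
          (fun hw => h.f1 0 hw h0) this
  · have hne : ∀ k, ρ k ≠ s := fun k hk => hvis ⟨k, hk⟩
    have hbn : ∀ i, ¬ b i := by
      intro i
      induction i with
      | zero => exact h0
      | succ i ih => exact fun hb => ih ((h.hb' i (hne i)).1 hb)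
    exact o1.2.2 ρ (fun i => ⟨h.play i, fun he => absurd he (hne i)⟩) (fun i hw => h.f1 i hw (hbn i))

open Classical in
/-- memory update -/
noncomputable def upd (s : S) (Q1 : S → Prop) (x : Bool × Option S) (t : S) : Bool × Option S :=
  (if x.2 = some s then decide (¬ Q1 t) else x.1, some t)

theorem half_aux (hd : ∀ s, G.c s ≤ d) (hs : G.owner s = j)
    (hQ : ∀ t, G.R s t → Q1 t ∨ Q2 t) (hQ1 : ∃ t, G.R s t ∧ Q1 t) (hQ2 : ∃ t, G.R s t ∧ Q2 t)
    (o1 : Opt d (cut G s Q1 hQ1) j σ1 v1) (o2 : Opt d (cut G s Q2 hQ2) j σ2 v2)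
    (hv : v2 s ≤ v1 s) : Half d G j := by
  classical
  let bit : List S → S → Bool := fun l t => (upd s Q1 (l.foldl (upd s Q1) (false, none)) t).1
  refine ⟨σ1, v1, fun l t => if bit l t then σ2 t else σ1 t, fun u => (o1.1 u).1, ?_, ?_, ?_⟩
  · intro l t
    dsimp only
    split_ifs
    · exact (o2.1 t).1
    · exact (o1.1 t).1
  · intro ρ hp hf
    refine o1.2.1 ρ (fun i => ⟨hp i, fun he => ?_⟩) hf
    rw [hf i (by rw [he, hs]), he]
    exact (o1.1 s).2 rfl
  · intro ρ hp hf
    let st : ℕ → Bool × Option S := fun i =>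
      (List.ofFn fun k : Fin i => ρ k.val).foldl (upd s Q1) (false, none)
    have hst : ∀ i, st (i + 1) = upd s Q1 (st i) (ρ i) := by
      intro i
      simp only [st]
      rw [List.ofFn_succ', List.concat_eq_append, List.foldl_append]
      simp
    have hm : Mixed G j s Q1 σ1 σ2 ρ (fun i => (st (i + 1)).1 = true) := by
      refine ⟨hp, ?_, ?_, ?_, ?_⟩
      · intro i hi
        rw [hst (i + 1)]
        have : (st (i + 1)).2 = some s := by rw [hst, ← hi]; rfl
        simp [upd, this]
      · intro i hi
        rw [hst (i + 1)]
        have : (st (i + 1)).2 ≠ some s := by rw [hst]; simpa [upd] using hi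
        simp [upd, this]
      · intro i hw hb
        rw [hst] at hb
        rw [hf i hw]
        exact if_pos hb
      · intro i hw hb
        rw [hst] at hb
        rw [hf i hw]
        exact if_neg hb
    refine hm.main hd hs hQ hQ1 hQ2 o1 o2 hv ?_
    rw [hst]
    simp [upd, st]

end key

noncomputable def nedges (G : ParityGame S) : ℕ := Set.ncard {p : S × S | G.R p.1 p.2}

theorem nedges_cut [Finite S] (G : ParityGame S) (s : S) (Q : S → Prop) (h : ∃ t, G.R s t ∧ Q t)
    {t : S} (ht : G.R s t) (hq : ¬ Q t) : nedges (cut G s Q h) < nedges G := by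
  apply Set.ncard_lt_ncard _ (Set.toFinite _)
  refine ⟨fun p hp => hp.1, fun hsub => ?_⟩
  have : (s, t) ∈ {p : S × S | (cut G s Q h).R p.1 p.2} := hsub ht
  exact hq (this.2 rfl)

theorem half_of_choice [Finite S] {d : ℕ} (G : ParityGame S) (hd : ∀ s, G.c s ≤ d) (j : Fin 2)
    (ih : ∀ H : ParityGame S, nedges H < nedges G → (∀ s, H.c s ≤ d) → ∃ σ v, Opt d H j σ v)
    {s t t' : S} (hs : G.owner s = j) (ht : G.R s t) (ht' : G.R s t') (hne : t ≠ t') :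
    Half d G j := by
  have hQ1 : ∃ u, G.R s u ∧ u = t := ⟨t, ht, rfl⟩
  have hQ2 : ∃ u, G.R s u ∧ u ≠ t := ⟨t', ht', hne.symm⟩
  obtain ⟨σ1, v1, o1⟩ := ih (cut G s (fun u => u = t) hQ1) (nedges_cut G s _ hQ1 ht' hne.symm) hd
  obtain ⟨σ2, v2, o2⟩ := ih (cut G s (fun u => u ≠ t) hQ2) (nedges_cut G s _ hQ2 ht (by simp)) hd
  rcases le_total (v2 s) (v1 s) with hv | hv
  · exact half_aux hd hs (fun u _ => em _) hQ1 hQ2 o1 o2 hv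
  · exact half_aux hd hs (fun u _ => (em _).symm) hQ2 hQ1 o2 o1 hv

theorem pos_of_half {d : ℕ} (G : ParityGame S) (j : Fin 2)
    (hno : ∀ s t t', G.owner s = 1 - j → G.R s t → G.R s t' → t = t') (h : Half d G j) :
    ∃ σ v, Opt d G j σ v := by
  obtain ⟨σ, v, g, hσ, hg, h1, h2⟩ := h
  refine ⟨σ, v, hσ, h1, fun ρ hp _ => h2 ρ hp fun i hi => ?_⟩
  exact hno _ _ _ hi (hp i) (hg _ _)

theorem positional [Finite S] {d : ℕ} (j : Fin 2) (n : ℕ) : ∀ (G : ParityGame S), nedges G = n →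
    (∀ s, G.c s ≤ d) → ∃ σ v, Opt d G j σ v := by
  induction n using Nat.strong_induction_on with
  | _ n ihn =>
  intro G hG hd
  have ih : ∀ H : ParityGame S, nedges H < nedges G → (∀ s, H.c s ≤ d) → ∃ σ v, Opt d H j σ v :=
    fun H hH hc => ihn _ (hG ▸ hH) H rfl hc
  have ih' : ∀ H : ParityGame S, nedges H < nedges G → (∀ s, H.c s ≤ d) →
      ∃ σ v, Opt d H (1 - j) σ v := by
    intro H hH hc
    obtain ⟨σ, v, ho⟩ := ih H hH hc
    exact ⟨σ, _, ho.opp⟩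
  by_cases hj : ∃ s t t', G.owner s = j ∧ G.R s t ∧ G.R s t' ∧ t ≠ t'
  · obtain ⟨s, t, t', hs, ht, ht', hne⟩ := hj
    have H1 := half_of_choice G hd j ih hs ht ht' hne
    by_cases hk : ∃ s t t', G.owner s = 1 - j ∧ G.R s t ∧ G.R s t' ∧ t ≠ t'
    · obtain ⟨s, t, t', hs, ht, ht', hne⟩ := hk
      obtain ⟨σb, vb, gb, hσb, hgb, hb1, hb2⟩ := half_of_choice G hd (1 - j) ih' hs ht ht' hne
      obtain ⟨σa, va, ga, hσa, hga, ha1, ha2⟩ := H1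
      rw [fin2_inv] at hb2
      classical
      have hle : ∀ u, - vb u ≤ va u := by
        intro u
        obtain ⟨ρ, h0, hp, hr⟩ := exists_play G
          (fun l x => if G.owner x = j then gb l x else ga l x) (fun l x => by
            dsimp only
            split_ifs
            · exact hgb _ _
            · exact hga _ _) u
        have e1 := ha2 ρ hp (fun i hi => by
          rw [hr i, if_neg]; rw [hi]; exact (fin2_ne j).symm)
        have e2 := hb2 ρ hp (fun i hi => by rw [hr i, if_pos hi])
        rw [fv_opp] at e2
        rw [h0] at e1 e2
        omega
      refine ⟨fun u => if G.owner u = j then σa u else σb u, va, ?_, ?_, ?_⟩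
      · intro u
        dsimp only
        split_ifs
        · exact hσa _
        · exact hσb _
      · intro ρ hp hf
        exact ha1 ρ hp (fun i hi => (hf i hi).trans (if_pos hi))
      · intro ρ hp hf
        have e := hb1 ρ hp (fun i hi => (hf i hi).trans (if_neg (by
          rw [hi]; exact (fin2_ne j).symm)))
        rw [fv_opp] at e
        have := hle (ρ 0)
        omega
    · refine pos_of_half G j (fun s t t' hs ht ht' => ?_) H1
      by_contra hne
      exact hk ⟨s, t, t', hs, ht, ht', hne⟩
  · have hno : ∀ s t t', G.owner s = j → G.R s t → G.R s t' → t = t' := by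
      intro s t t' hs ht ht'
      by_contra hne
      exact hj ⟨s, t, t', hs, ht, ht', hne⟩
    by_cases hk : ∃ s t t', G.owner s = 1 - j ∧ G.R s t ∧ G.R s t' ∧ t ≠ t'
    · obtain ⟨s, t, t', hs, ht, ht', hne⟩ := hk
      obtain ⟨σ, v, ho⟩ := pos_of_half G (1 - j) (by rw [fin2_inv]; exact hno)
        (half_of_choice G hd (1 - j) ih' hs ht ht' hne)
      have := ho.opp
      rw [fin2_inv] at this
      exact ⟨σ, _, this⟩
    · have hdet : ∀ s t t', G.R s t → G.R s t' → t = t' := by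
        intro s t t' ht ht'
        rcases fin2_cases (G.owner s) j with h | h
        · exact hno s t t' h ht ht'
        · by_contra hne
          exact hk ⟨s, t, t', h, ht, ht', hne⟩
      choose σ hσ using G.total
      have hpl : ∀ ρ, G.IsPlay ρ → ρ = fun i => σ^[i] (ρ 0) := by
        intro ρ hp
        funext i
        induction i with
        | zero => rfl
        | succ i ih =>
          rw [Function.iterate_succ_apply', ← ih]
          exact hdet _ _ _ (hp i) (hσ _)
      refine ⟨σ, fun u => fv d j (G.colorSeq fun i => σ^[i] u), hσ, ?_, ?_⟩
      · intro ρ hp _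
        dsimp only
        rw [← hpl ρ hp]
      · intro ρ hp _
        dsimp only
        rw [← hpl ρ hp]

end PGProof

open PGProof
/-- Player `j` has a single memoryless strategy `σ` such that:
(1) from every winning core state, every compatible play has color sequence in `Λ_j`;
(2) from every winning state, every compatible play has color sequence in `Ω_j`;
(3) from every state outside the opponent's winning core, no compatible play has
color sequence in `Λ_{1-j}`. -/
theorem exists_memoryless_core_strategy {S : Type} [Fintype S] (G : ParityGame S)
    (j : Fin 2) :
    ∃ σ, G.IsStrategy σ ∧ Memoryless σ ∧
      (∀ s ∈ G.WinCore j, ∀ ρ, G.IsPlay ρ → ρ 0 = s → G.Compatible j σ ρ →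
        InLambda j (G.colorSeq ρ)) ∧
      (∀ s ∈ G.WinRegion j, ∀ ρ, G.IsPlay ρ → ρ 0 = s → G.Compatible j σ ρ →
        InOmega j (G.colorSeq ρ)) ∧
      (∀ s, s ∉ G.WinCore (1 - j) → ∀ ρ, G.IsPlay ρ → ρ 0 = s → G.Compatible j σ ρ →
        ¬ InLambda (1 - j) (G.colorSeq ρ)) := by
  classical
  obtain ⟨d, hd⟩ : ∃ d, ∀ s, G.c s ≤ d :=
    ⟨Finset.univ.sup G.c, fun s => Finset.le_sup (f := G.c) (Finset.mem_univ s)⟩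
  have hb : ∀ ρ i, G.colorSeq ρ i ≤ d := fun ρ i => hd _
  obtain ⟨σ, v, hσ, h1, h2⟩ := positional (d := d) j _ G rfl hd
  -- play of an arbitrary strategy of `j` against `σ`
  have joint : ∀ (g : List S → S → S), G.IsStrategy g → ∀ s, ∃ ρ, ρ 0 = s ∧ G.IsPlay ρ ∧
      G.Compatible j g ρ ∧ Fol G (1 - j) σ ρ := by
    intro g hg s
    obtain ⟨ρ, h0, hp, hr⟩ := exists_play G
      (fun l x => if G.owner x = j then g l x else σ x) (fun l x => by
        dsimp only
        split_ifs
        · exact hg _ _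
        · exact hσ _) s
    refine ⟨ρ, h0, hp, fun i hi => by rw [hr i, if_pos hi], fun i hi => ?_⟩
    rw [hr i, if_neg]; rw [hi]; exact (fin2_ne j).symm
  refine ⟨fun _ s => σ s, fun _ s => hσ s, fun _ _ _ => rfl, ?_, ?_, ?_⟩
  · rintro s ⟨g, hg, hw⟩ ρ hp h0 hc
    obtain ⟨ρ', h0', hp', hc', hf'⟩ := joint g hg s
    have e := hw ρ' hp' h0' hc'
    rw [beginsInfDom_iff G hd, inLambda_fv (hb ρ')] at e
    have e2 := h2 ρ' hp' hf'
    have e3 := h1 ρ hp hc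
    rw [inLambda_fv (hb ρ)]
    rw [h0'] at e2
    rw [h0] at e3
    omega
  · rintro s ⟨g, hg, hw⟩ ρ hp h0 hc
    obtain ⟨ρ', h0', hp', hc', hf'⟩ := joint g hg s
    have e := hw ρ' hp' h0' hc'
    rw [inOmega_fv (hb ρ')] at e
    have e2 := h2 ρ' hp' hf'
    have e3 := h1 ρ hp hc
    rw [inOmega_fv (hb ρ)]
    rw [h0'] at e2
    rw [h0] at e3
    omega
  · intro s hs ρ hp h0 hc hL
    apply hs
    refine ⟨fun _ s => σ s, fun _ s => hσ s, fun ρ' hp' h0' hc' => ?_⟩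
    rw [beginsInfDom_iff G hd, inLambda_fv (hb ρ'), fv_opp]
    rw [inLambda_fv (hb ρ), fv_opp] at hL
    have e2 := h2 ρ' hp' hc'
    have e3 := h1 ρ hp hc
    rw [h0'] at e2
    rw [h0] at e3
    omega
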